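/- Let D be a database and Σ ∈ L a finite set of linear TGDs such that simple(Σ) is simple(D)-weakly-acyclic. Then maxdepth(D,Σ) ≤ d_L(Σ), where d_L(Σ) = |sch(Σ)|·ar(Σ)^{ar(Σ)+1}. -/

import Mathlib

set_option maxHeartbeats 1000000

/-! ### Basic syntax: atoms, TGDs, terms -/

/-- An atom: a predicate name together with a list of arguments. -/
structure Atom (T : Type) where
  pred : ℕ
  args : List T
deriving DecidableEq

def Atom.map {T U : Type} (f : T → U) (a : Atom T) : Atom U :=
  ⟨a.pred, a.args.map f⟩

/-- The signature (predicate name, arity) of an atom. -/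
def Atom.sig {T : Type} (a : Atom T) : ℕ × ℕ := (a.pred, a.args.length)

def Atom.equivProd : Atom ℕ ≃ ℕ × List ℕ where
  toFun a := (a.pred, a.args)
  invFun p := ⟨p.1, p.2⟩
  left_inv a := rfl
  right_inv p := rfl

instance : Encodable (Atom ℕ) := Encodable.ofEquiv _ Atom.equivProd

/-- A tuple-generating dependency, given by its (non-empty) body and head,
whose atoms carry variables (natural numbers) as arguments. -/
structure TGD where
  body : List (Atom ℕ)
  head : List (Atom ℕ)
  body_ne : body ≠ []
  head_ne : head ≠ []

def atomVars (a : Atom ℕ) : Finset ℕ := a.args.toFinset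

def TGD.bodyVars (σ : TGD) : Finset ℕ := σ.body.foldr (fun a s => atomVars a ∪ s) ∅
def TGD.headVars (σ : TGD) : Finset ℕ := σ.head.foldr (fun a s => atomVars a ∪ s) ∅
/-- The frontier of a TGD: variables occurring both in the body and in the head. -/
def TGD.frontier (σ : TGD) : Finset ℕ := σ.bodyVars ∩ σ.headVars
/-- The existentially quantified variables: head variables not occurring in the body. -/
def TGD.exVars (σ : TGD) : Finset ℕ := σ.headVars \ σ.bodyVars

/-- Terms: constants, and labelled nulls `⊥^z_{σ,h}` determined by a TGD `σ`,
a substitution `h` (the restriction of the trigger homomorphism to the frontier)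
and a variable `z`. -/
inductive TermT : Type where
  | const : ℕ → TermT
  | null : TGD → (ℕ → TermT) → ℕ → TermT

/-- The depth of a term. -/
def TermT.depth : TermT → ℕ
  | .const _ => 0
  | .null σ h _ => 1 + σ.frontier.sup (fun x => (h x).depth)

/-- The depth of an atom: the maximal depth of its arguments. -/
def Atom.depth (a : Atom TermT) : ℕ := (a.args.map TermT.depth).foldr max 0

/-! ### The semi-oblivious chase -/

/-- Restriction of a substitution to the frontier of a TGD (with default value elsewhere). -/
def TGD.restrict (σ : TGD) (h : ℕ → TermT) : ℕ → TermT :=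
  fun x => if x ∈ σ.frontier then h x else .const 0

/-- The map `μ` sending each frontier variable `x` to `h x` and each other (existential)
variable `z` to the null `⊥^z_{σ,h|fr(σ)}`. -/
def TGD.mu (σ : TGD) (h : ℕ → TermT) : ℕ → TermT :=
  fun x => if x ∈ σ.frontier then h x else .null σ (σ.restrict h) x

/-- The result of the trigger `(σ,h)`. -/
def TGD.result (σ : TGD) (h : ℕ → TermT) : Set (Atom TermT) :=
  {a | ∃ b ∈ σ.head, a = b.map (σ.mu h)}

abbrev Database := Finset (Atom ℕ)
abbrev Instance := Set (Atom TermT)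

def dbInstance (D : Database) : Instance := (Atom.map TermT.const) '' ↑D

/-- `chase D S` (the result of any valid semi-oblivious chase derivation of `D` w.r.t. `S`),
defined as the least set of atoms containing `D` and closed under all triggers. -/
inductive InChase (D : Database) (S : Set TGD) : Atom TermT → Prop
  | db {a : Atom ℕ} : a ∈ D → InChase D S (a.map TermT.const)
  | step {σ : TGD} (hσ : σ ∈ S) (h : ℕ → TermT)
      (hb : ∀ b ∈ σ.body, InChase D S (b.map h))
      {a : Atom TermT} (ha : a ∈ σ.result h) : InChase D S a

def chase (D : Database) (S : Set TGD) : Instance := {a | InChase D S a}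

/-- The active domain of an instance: the set of terms occurring in it. -/
def adom (I : Instance) : Set TermT := {t | ∃ a ∈ I, t ∈ a.args}

/-- `Σ ∈ CT_D`: the chase of `D` w.r.t. `Σ` is finite. -/
def InCT (D : Database) (S : Set TGD) : Prop := (chase D S).Finite

open Classical in
/-- The maximal depth of a term occurring in `chase D S`, and `⊤` if the chase is infinite. -/
noncomputable def maxdepth (D : Database) (S : Set TGD) : ℕ∞ :=
  if (chase D S).Finite then ⨆ t ∈ adom (chase D S), (TermT.depth t : ℕ∞) else ⊤

/-! ### Schema, arity, classes of TGDs -/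

def TGD.atomsList (σ : TGD) : List (Atom ℕ) := σ.body ++ σ.head

/-- The schema of a set of TGDs: the (predicate name, arity) pairs occurring in it. -/
def sch (S : Set TGD) : Set (ℕ × ℕ) := {p | ∃ σ ∈ S, ∃ a ∈ σ.atomsList, a.sig = p}

/-- The maximal arity of a predicate of the schema. -/
noncomputable def arity (S : Set TGD) : ℕ := sSup ((fun p => p.2) '' sch S)

/-- The set of atoms occurring in the TGDs of `S`. -/
def atomsOf (S : Set TGD) : Set (Atom ℕ) := {a | ∃ σ ∈ S, a ∈ σ.atomsList}

/-- `‖Σ‖ = |atoms(Σ)| · |sch(Σ)| · ar(Σ)`. -/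
noncomputable def tgdNorm (S : Set TGD) : ℕ := (atomsOf S).ncard * (sch S).ncard * arity S

/-- A TGD is guarded if some body atom contains all body variables. -/
def TGD.Guarded (σ : TGD) : Prop := ∃ a ∈ σ.body, σ.bodyVars ⊆ atomVars a

/-- A TGD is linear if its body consists of a single atom. -/
def TGD.Linear (σ : TGD) : Prop := ∃ a, σ.body = [a]

/-- A TGD is simple linear if its body is a single atom without repeated variables. -/
def TGD.SimpleLinear (σ : TGD) : Prop := ∃ a, σ.body = [a] ∧ a.args.Nodup

/-- The guard of a TGD: the leftmost body atom containing all body variables. -/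
def TGD.guard (σ : TGD) : Atom ℕ :=
  (σ.body.find? (fun a => decide (σ.bodyVars ⊆ atomVars a))).getD ⟨0, []⟩

/-! ### Chase derivations and the guarded chase forest -/

def IsTrigger (S : Set TGD) (σ : TGD) (h : ℕ → TermT) (I : Instance) : Prop :=
  σ ∈ S ∧ ∀ b ∈ σ.body, b.map h ∈ I

def IsActive (S : Set TGD) (σ : TGD) (h : ℕ → TermT) (I : Instance) : Prop :=
  IsTrigger S σ h I ∧ ¬ σ.result h ⊆ I

/-- A chase derivation of `D` w.r.t. `S`: at each step either an active trigger is applied,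
or no active trigger exists and the instance stays put (the derivation has terminated). -/
structure ChaseDerivation (D : Database) (S : Set TGD) where
  inst : ℕ → Instance
  trig : ℕ → Option (TGD × (ℕ → TermT))
  init : inst 0 = dbInstance D
  step_some : ∀ i σ h, trig i = some (σ, h) →
    IsActive S σ h (inst i) ∧ inst (i + 1) = inst i ∪ σ.result h
  step_none : ∀ i, trig i = none →
    (∀ σ h, ¬ IsActive S σ h (inst i)) ∧ inst (i + 1) = inst i

/-- The derivation is finite: it eventually reaches an instance with no active trigger. -/
def ChaseDerivation.IsFiniteDer {D : Database} {S : Set TGD} (δ : ChaseDerivation D S) : Prop :=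
  ∃ i, δ.trig i = none

/-- Fairness: every active trigger eventually becomes non-active. -/
def ChaseDerivation.Fair {D : Database} {S : Set TGD} (δ : ChaseDerivation D S) : Prop :=
  ∀ i σ h, IsActive S σ h (δ.inst i) → ∃ j, i < j ∧ ¬ IsActive S σ h (δ.inst j)

def ChaseDerivation.Valid {D : Database} {S : Set TGD} (δ : ChaseDerivation D S) : Prop :=
  δ.IsFiniteDer ∨ δ.Fair

/-- The edge relation of the guarded chase forest of a derivation. -/
def gedge {D : Database} {S : Set TGD} (δ : ChaseDerivation D S) (α β : Atom TermT) : Prop :=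
  ∃ i σ h, δ.trig i = some (σ, h) ∧ α = (TGD.guard σ).map h ∧
    β ∈ δ.inst (i + 1) \ δ.inst i

/-- The tree of the guarded chase forest rooted at the database atom `α`. -/
def gtree {D : Database} {S : Set TGD} (δ : ChaseDerivation D S) (α : Atom ℕ) : Set (Atom TermT) :=
  {β | Relation.ReflTransGen (gedge δ) (α.map TermT.const) β}

/-- The atoms of depth `i` in the tree rooted at `α`. -/
def gtreeLevel {D : Database} {S : Set TGD} (δ : ChaseDerivation D S) (α : Atom ℕ) (i : ℕ) :
    Set (Atom TermT) :=
  {β ∈ gtree δ α | Atom.depth β = i}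

/-! ### Dependency graph, reachability and non-uniform weak-acyclicity -/

/-- A position `(R, i)` of a schema: a (predicate name, arity) pair and an argument index. -/
abbrev Pos := (ℕ × ℕ) × ℕ

def occursAt {T : Type} (x : T) (a : Atom T) (p : Pos) : Prop :=
  p.1 = a.sig ∧ a.args[p.2]? = some x

/-- Normal edges of the dependency graph. -/
def NormalEdge (S : Set TGD) (p q : Pos) : Prop :=
  ∃ σ ∈ S, ∃ x ∈ σ.frontier, (∃ a ∈ σ.body, occursAt x a p) ∧ (∃ b ∈ σ.head, occursAt x b q)

/-- Special edges of the dependency graph. -/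
def SpecialEdge (S : Set TGD) (p q : Pos) : Prop :=
  ∃ σ ∈ S, ∃ x ∈ σ.frontier, (∃ a ∈ σ.body, occursAt x a p) ∧
    (∃ z ∈ σ.exVars, ∃ b ∈ σ.head, occursAt z b q)

def predEdge (S : Set TGD) (R P : ℕ × ℕ) : Prop :=
  ∃ σ ∈ S, (∃ a ∈ σ.body, a.sig = R) ∧ (∃ b ∈ σ.head, b.sig = P)

/-- `R ⤳_Σ P`: predicate reachability. -/
def Reach (S : Set TGD) : (ℕ × ℕ) → (ℕ × ℕ) → Prop := Relation.ReflTransGen (predEdge S)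

/-- `Σ` is `D`-weakly-acyclic: no `D`-supported cycle of the dependency graph
contains a special edge. -/
def DWeaklyAcyclic (D : Database) (S : Set TGD) : Prop :=
  ¬ ∃ (n : ℕ) (c : ℕ → Pos) (sp : ℕ → Bool),
      c (n + 1) = c 0 ∧
      (∀ i ≤ n, if sp i then SpecialEdge S (c i) (c (i + 1))
                else NormalEdge S (c i) (c (i + 1))) ∧
      (∃ i ≤ n, sp i = true) ∧
      (∃ i ≤ n, ∃ a ∈ D, Reach S a.sig (c i).1)

noncomputable def dSL (S : Set TGD) : ℕ := (sch S).ncard * arity S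
noncomputable def fSL (S : Set TGD) : ℕ := (dSL S + 1) * tgdNorm S ^ (2 * arity S * (dSL S + 1))
noncomputable def dL (S : Set TGD) : ℕ := (sch S).ncard * arity S ^ (arity S + 1)
noncomputable def fL (S : Set TGD) : ℕ := (dL S + 1) * tgdNorm S ^ (2 * arity S * (dL S + 1))
noncomputable def dG (S : Set TGD) : ℕ :=
  (sch S).ncard * arity S ^ (2 * arity S + 1) * 2 ^ ((sch S).ncard * arity S ^ arity S)
noncomputable def fG (S : Set TGD) : ℕ := (dG S + 1) * tgdNorm S ^ (2 * arity S * (dG S + 1))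

/-! ### Simplification -/

open Classical in
/-- `unique(t̄)`: keep only the first occurrence of each term. -/
noncomputable def uniqueList {α : Type} : List α → List α
  | [] => []
  | a :: l => a :: uniqueList (l.filter fun b => decide (b ≠ a))
termination_by l => l.length
decreasing_by
  simp only [List.length_cons, List.length_unattach]
  exact Nat.lt_succ_of_le ((List.length_filter_le _ _).trans (le_of_eq List.length_attach))

open Classical in
/-- `id(t̄)`: for each component, the position of `unique(t̄)` at which it appears. -/
noncomputable def idTuple {α : Type} (l : List α) : List ℕ :=
  l.map (fun t => (uniqueList l).idxOf t)

/-- The simplification of an atom `R(t̄)`: the atom `R_{id(t̄)}(unique(t̄))`, where the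
fresh predicate name `R_{id(t̄)}` is obtained by pairing `R` with an encoding of `id(t̄)`. -/
noncomputable def simpleAtom {α : Type} (a : Atom α) : Atom α :=
  ⟨Nat.pair a.pred (Encodable.encode (idTuple a.args)), uniqueList a.args⟩

/-- `simple(D)`. -/
noncomputable def simpleDB (D : Database) : Database := D.image simpleAtom

/-- A specialization of the tuple of variables `xs`:
`f x₁ = x₁`, `f xᵢ ∈ {f x₁, …, f xᵢ₋₁, xᵢ}`, and `f` is the identity off `xs`. -/
def IsSpecialization (xs : List ℕ) (f : ℕ → ℕ) : Prop :=
  (∀ v, v ∉ xs → f v = v) ∧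
  ∀ i : Fin xs.length, f (xs.get i) ∈ ((xs.take i).map f) ++ [xs.get i]

/-- The body atom of a (linear) TGD. -/
def TGD.bodyAtom (σ : TGD) : Atom ℕ := σ.body.head σ.body_ne

/-- The simplification of a linear TGD induced by a specialization `f`. -/
noncomputable def TGD.simplify (σ : TGD) (f : ℕ → ℕ) : TGD where
  body := [simpleAtom (σ.bodyAtom.map f)]
  head := σ.head.map (fun b => simpleAtom (b.map f))
  body_ne := by simp
  head_ne := by
    intro hcon
    exact σ.head_ne (List.map_eq_nil_iff.mp hcon)

/-- `simple(Σ)`: all simplifications of TGDs of `Σ` induced by some specialization. -/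
def simpleTGDs (S : Set TGD) : Set TGD :=
  {τ | ∃ σ ∈ S, ∃ f : ℕ → ℕ, IsSpecialization σ.bodyAtom.args f ∧ τ = σ.simplify f}

/-- Equivalence of terms up to simplification: the map
`g = {f x ↦ h x : x ∈ fr(σ)}` is a well-defined function on `fr(σ_f)` (witnessed by the
section `sec` of `f`), and `g y ≡_sim h' y` for every `y ∈ fr(σ_f)`. -/
inductive EqSim : TermT → TermT → Prop
  | const (c : ℕ) : EqSim (.const c) (.const c)
  | null (σ : TGD) (f : ℕ → ℕ) (sec : ℕ → ℕ) (h h' : ℕ → TermT) (z : ℕ)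
      (hf : IsSpecialization σ.bodyAtom.args f)
      (hfun : ∀ x ∈ σ.frontier, ∀ y ∈ σ.frontier, f x = f y → h x = h y)
      (hdom : ∀ x ∈ σ.frontier, f x ∈ (σ.simplify f).frontier)
      (hsec : ∀ y ∈ (σ.simplify f).frontier, sec y ∈ σ.frontier ∧ f (sec y) = y)
      (hrec : ∀ y ∈ (σ.simplify f).frontier, EqSim (h (sec y)) (h' y)) :
      EqSim (.null σ h z) (.null (σ.simplify f) h' z)

/-- `t̄ ≃ ū`: same length and the same equalities among components. -/
def tupleEquiv {A B : Type} (t : List A) (u : List B) : Prop :=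
  t.length = u.length ∧ ∀ i j, i < t.length → j < t.length → (t[i]? = t[j]? ↔ u[i]? = u[j]?)

/-- Equivalence of atoms up to simplification. -/
noncomputable def AtomEqSim (α β : Atom TermT) : Prop :=
  β.pred = Nat.pair α.pred (Encodable.encode (idTuple α.args)) ∧
  tupleEquiv (uniqueList α.args) β.args ∧
  List.Forall₂ EqSim (uniqueList α.args) β.args

/-! ### Linearization -/

/-- The symbolic representation of a type: a canonical guard atom over positive integers
together with a finite set of further atoms over its terms. -/
abbrev SigmaType := Atom ℕ × Finset (Atom ℕ)

/-- A canonical tuple of positive integers: `t₁ = 1` and `tᵢ ≤ max(t₁,…,tᵢ₋₁) + 1`. -/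
def IsCanonicalTuple (l : List ℕ) : Prop :=
  ∀ (i : ℕ) (h : i < l.length), 1 ≤ l[i] ∧ l[i] ≤ ((l.take i).foldr max 0) + 1

def atomsOfType (τ : SigmaType) : Finset (Atom ℕ) := insert τ.1 τ.2

def IsSigmaType (S : Set TGD) (τ : SigmaType) : Prop :=
  IsCanonicalTuple τ.1.args ∧ τ.1.sig ∈ sch S ∧
  (∀ b ∈ τ.2, b.sig ∈ sch S ∧ ∀ t ∈ b.args, t ∈ τ.1.args) ∧ τ.1 ∉ τ.2

open Classical in
noncomputable def setToFinset {α : Type} (s : Set α) : Finset α :=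
  if h : s.Finite then h.toFinset else ∅

open Classical in
/-- Canonical renaming: the `i`-th distinct value of `base` (by first occurrence)
is sent to the integer `i` (1-based). -/
noncomputable def canonInt {α : Type} (base : List α) (c : α) : ℕ :=
  (uniqueList base).idxOf c + 1

/-- The type (over the constants of `a`) of the database atom `a` w.r.t. `D` and `S`. -/
def typeOfDBAtom (D : Database) (S : Set TGD) (a : Atom ℕ) : Set (Atom ℕ) :=
  {b | (b.map TermT.const) ∈ chase D S ∧ ∀ c ∈ b.args, c ∈ a.args}

/-- The linearization of a database atom: `[τ](t̄)` where `τ` encodes the atom and its type. -/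
noncomputable def linAtom (D : Database) (S : Set TGD) (a : Atom ℕ) : Atom ℕ :=
  let ρ : ℕ → ℕ := canonInt a.args
  let g : Atom ℕ := a.map ρ
  let τ : SigmaType := (g, (setToFinset ((Atom.map ρ) '' typeOfDBAtom D S a)).erase g)
  ⟨Encodable.encode τ, a.args⟩

/-- `lin(D)`. -/
noncomputable def linDB (D : Database) (S : Set TGD) : Database := D.image (linAtom D S)

/-- `complete(I,Σ)`: the atoms of the chase of `I` whose terms all belong to `adom(I)`. -/
def completeDB (I : Database) (S : Set TGD) : Set (Atom ℕ) :=
  {a | (a.map TermT.const) ∈ chase I S ∧ ∀ c ∈ a.args, ∃ b ∈ I, c ∈ b.args}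

/-- The index (1-based) of an existential variable of a TGD. -/
noncomputable def TGD.exIndex (σ : TGD) (v : ℕ) : ℕ := (σ.exVars.sort (· ≤ ·)).idxOf v + 1

/-- The function `f` of the linearization: frontier variables are mapped by `h`, the `i`-th
existential variable to `ar(Σ) + i`. -/
noncomputable def headMap (S : Set TGD) (σ : TGD) (h : ℕ → ℕ) : ℕ → ℕ :=
  fun v => if v ∈ σ.frontier then h v else arity S + σ.exIndex v

/-- The Σ-type associated with the head atom `b` of `σ` in the linearization step. -/
noncomputable def headTypeOf (S : Set TGD) (σ : TGD) (τ : SigmaType) (h : ℕ → ℕ)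
    (b : Atom ℕ) : SigmaType :=
  let f := headMap S σ h
  let αi : Atom ℕ := b.map f
  let I : Database := (σ.head.map (Atom.map f)).toFinset ∪ atomsOfType τ
  let Ti : Set (Atom ℕ) := {β | β ∈ completeDB I S ∧ ∀ t ∈ β.args, t ∈ αi.args} \ {αi}
  let ρ : ℕ → ℕ := canonInt αi.args
  (αi.map ρ, setToFinset ((Atom.map ρ) '' Ti))

/-- The linearization of the guarded TGD `σ` induced by the Σ-type `τ` and the
homomorphism `h` from `body(σ)` to `atoms(τ)` mapping the guard to `guard(τ)`. -/
noncomputable def linTGD (S : Set TGD) (σ : TGD) (τ : SigmaType) (h : ℕ → ℕ) : TGD where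
  body := [⟨Encodable.encode τ, σ.guard.args⟩]
  head := σ.head.map (fun b => ⟨Encodable.encode (headTypeOf S σ τ h b), b.args⟩)
  body_ne := by simp
  head_ne := by
    intro hcon
    exact σ.head_ne (List.map_eq_nil_iff.mp hcon)

def IsTypeHom (S : Set TGD) (σ : TGD) (τ : SigmaType) (h : ℕ → ℕ) : Prop :=
  (∀ b ∈ σ.body, b.map h ∈ atomsOfType τ) ∧ σ.guard.map h = τ.1

/-- `lin(Σ)`. -/
def linTGDs (S : Set TGD) : Set TGD :=
  {ρ | ∃ σ ∈ S, ∃ τ : SigmaType, IsSigmaType S τ ∧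
    ∃ h : ℕ → ℕ, IsTypeHom S σ τ h ∧ ρ = linTGD S σ τ h}

/-- Equivalence of terms up to linearization. -/
inductive EqLin (S : Set TGD) : TermT → TermT → Prop
  | const (c : ℕ) : EqLin S (.const c) (.const c)
  | null (σ : TGD) (τ : SigmaType) (g : ℕ → ℕ) (h h' : ℕ → TermT) (z : ℕ)
      (hτ : IsSigmaType S τ) (hg : IsTypeHom S σ τ g)
      (hfr : ∀ y ∈ (linTGD S σ τ g).frontier, EqLin S (h y) (h' y)) :
      EqLin S (.null σ h z) (.null (linTGD S σ τ g) h' z)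

/-- The type of an atom of the chase: all chase atoms whose terms occur in it. -/
def typeOf (D : Database) (S : Set TGD) (α : Atom TermT) : Set (Atom TermT) :=
  {β ∈ chase D S | ∀ t ∈ β.args, t ∈ α.args}

/-- Equivalence of atoms up to linearization. -/
def AtomEqLin (D : Database) (S : Set TGD) (α β : Atom TermT) : Prop :=
  ∃ τ : SigmaType, β.pred = Encodable.encode τ ∧ IsSigmaType S τ ∧
    (∃ μ : TermT → ℕ,
      Set.BijOn μ (adom (typeOf D S α)) {k | ∃ a ∈ atomsOfType τ, k ∈ a.args} ∧
      (Atom.map μ) '' typeOf D S α = ↑(atomsOfType τ) ∧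
      α.map μ = τ.1) ∧
    tupleEquiv α.args β.args ∧ List.Forall₂ (EqLin S) α.args β.args

noncomputable def gsimpleDB (D : Database) (S : Set TGD) : Database := simpleDB (linDB D S)
def gsimpleTGDs (S : Set TGD) : Set TGD := simpleTGDs (linTGDs S)


section Helpers

theorem aux_uniq_nil {α : Type} : uniqueList ([] : List α) = [] := by
  rw [uniqueList]

open Classical in
theorem aux_uniq_cons {α : Type} (a : α) (l : List α) :
    uniqueList (a :: l) = a :: uniqueList (l.filter fun b => decide (b ≠ a)) := by
  rw [uniqueList]

open Classical in
theorem aux_uniq_main {α β : Type} (n : ℕ) : ∀ (l : List α), l.length ≤ n →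
    (∀ x, x ∈ uniqueList l ↔ x ∈ l) ∧ (uniqueList l).length ≤ l.length ∧
    ∀ g : α → β, (∀ x ∈ l, ∀ y ∈ l, g x = g y → x = y) →
      uniqueList (l.map g) = (uniqueList l).map g := by
  induction n with
  | zero =>
    intro l hl
    have : l = [] := List.length_eq_zero_iff.mp (by omega)
    subst this
    simp [aux_uniq_nil]
  | succ n ih =>
    intro l hl
    cases l with
    | nil => simp [aux_uniq_nil]
    | cons a l =>
      have hlen := List.length_filter_le (fun b => decide (b ≠ a)) l
      obtain ⟨h1, h2, h3⟩ := ih (l.filter fun b => decide (b ≠ a)) (by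
        simp only [List.length_cons] at hl; omega)
      refine ⟨?_, ?_, ?_⟩
      · intro x
        rw [aux_uniq_cons, List.mem_cons, List.mem_cons, h1]
        by_cases hx : x = a <;> simp [hx]
      · rw [aux_uniq_cons]; simp only [List.length_cons]; omega
      · intro g hg
        rw [aux_uniq_cons, List.map_cons, aux_uniq_cons, List.map_cons, ← h3 g]
        · congr 2
          rw [List.filter_map]
          congr 1
          apply List.filter_congr
          intro x hx
          have : g x = g a ↔ x = a :=
            ⟨fun h => hg x (by simp [hx]) a (by simp) h, fun h => by rw [h]⟩
          simp [this]
        · intro x hx y hy h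
          exact hg x (List.mem_cons_of_mem _ (List.mem_of_mem_filter hx)) y
            (List.mem_cons_of_mem _ (List.mem_of_mem_filter hy)) h

theorem aux_mem_uniq {α : Type} (l : List α) (x : α) : x ∈ uniqueList l ↔ x ∈ l :=
  (aux_uniq_main (β := α) l.length l le_rfl).1 x

theorem aux_len_uniq {α : Type} (l : List α) : (uniqueList l).length ≤ l.length :=
  (aux_uniq_main (β := α) l.length l le_rfl).2.1

theorem aux_uniq_map {α β : Type} (l : List α) (g : α → β)
    (hg : ∀ x ∈ l, ∀ y ∈ l, g x = g y → x = y) :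
    uniqueList (l.map g) = (uniqueList l).map g :=
  (aux_uniq_main l.length l le_rfl).2.2 g hg

open Classical in
theorem aux_idxOf_map {α β : Type} (g : α → β) (x : α) : ∀ (l : List α)
    (_ : ∀ y ∈ l, g y = g x → y = x), (l.map g).idxOf (g x) = l.idxOf x := by
  intro l
  induction l with
  | nil => intro _; simp
  | cons a l ih =>
    intro h
    rw [List.map_cons, List.idxOf_cons, List.idxOf_cons, ih (fun y hy => h y (by simp [hy]))]
    have : g a = g x ↔ a = x := ⟨h a (by simp), fun h => by rw [h]⟩
    by_cases hx : a = x
    · simp [hx]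
    · have : ¬ g a = g x := fun h' => hx (this.mp h')
      rw [beq_eq_false_iff_ne.2 hx, beq_eq_false_iff_ne.2 this]

open Classical in
theorem aux_id_map {α β : Type} (l : List α) (g : α → β)
    (hg : ∀ x ∈ l, ∀ y ∈ l, g x = g y → x = y) :
    idTuple (l.map g) = idTuple l := by
  unfold idTuple
  rw [aux_uniq_map l g hg, List.map_map]
  apply List.map_congr_left
  intro x hx
  exact aux_idxOf_map g x _ (fun y hy h => hg y ((aux_mem_uniq _ _).1 hy) x hx h)

theorem aux_simple_map {α β : Type} (a : Atom α) (g : α → β)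
    (hg : ∀ x ∈ a.args, ∀ y ∈ a.args, g x = g y → x = y) :
    simpleAtom (a.map g) = (simpleAtom a).map g := by
  simp only [simpleAtom, Atom.map, aux_uniq_map a.args g hg, aux_id_map a.args g hg]

theorem aux_len_idTuple {α : Type} (l : List α) : (idTuple l).length = l.length := by
  simp [idTuple]

open Classical in
theorem aux_uniq_idTuple {α : Type} (l : List α) :
    (uniqueList (idTuple l)).length = (uniqueList l).length := by
  unfold idTuple
  rw [aux_uniq_map, List.length_map]
  intro x hx y hy h
  exact (List.idxOf_inj ((aux_mem_uniq _ _).2 hx)).1 h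

open Classical in
theorem aux_idTuple_lt {α : Type} (l : List α) (k : ℕ) (hk : k ∈ idTuple l) :
    k < (uniqueList l).length := by
  unfold idTuple at hk
  obtain ⟨x, hx, rfl⟩ := List.mem_map.1 hk
  exact List.idxOf_lt_length_of_mem ((aux_mem_uniq _ _).2 hx)

/-! dependency graph -/

def AEdge (S : Set TGD) (p q : Pos) : Prop := NormalEdge S p q ∨ SpecialEdge S p q

def ASp (S : Set TGD) (p q : Pos) : Prop :=
  ∃ r s, Relation.ReflTransGen (AEdge S) p r ∧ SpecialEdge S r s ∧
    Relation.ReflTransGen (AEdge S) s q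

def APath (S : Set TGD) (b : Bool) (p q : Pos) : Prop :=
  ∃ (n : ℕ) (c : ℕ → Pos) (sp : ℕ → Bool), c 0 = p ∧ c n = q ∧
    (∀ i < n, if sp i then SpecialEdge S (c i) (c (i + 1)) else NormalEdge S (c i) (c (i + 1))) ∧
    (b = true → ∃ i < n, sp i = true)

theorem APath.cons {S : Set TGD} {b : Bool} {p q r : Pos} (s : Bool)
    (he : if s then SpecialEdge S p q else NormalEdge S p q) (h : APath S b q r) :
    APath S (s || b) p r := by
  obtain ⟨n, c, sp, h0, hn, he', hb⟩ := h
  refine ⟨n + 1, fun i => Nat.casesOn i p c, fun i => Nat.casesOn i s sp, rfl, hn, ?_, ?_⟩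
  · intro i hi
    cases i with
    | zero => simpa [h0] using he
    | succ i => exact he' i (by omega)
  · intro hsb
    cases hs : s with
    | true => exact ⟨0, by omega, rfl⟩
    | false =>
      subst hs
      obtain ⟨i, hi, h⟩ := hb (by simpa using hsb)
      exact ⟨i + 1, by omega, h⟩

theorem APath.weak {S : Set TGD} {b b' : Bool} {p q : Pos} (hb : b' = true → b = true)
    (h : APath S b p q) : APath S b' p q := by
  obtain ⟨n, c, sp, h0, hn, he', h⟩ := h
  exact ⟨n, c, sp, h0, hn, he', fun h' => h (hb h')⟩

theorem APath.rtg {S : Set TGD} {b : Bool} {p q r : Pos}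
    (h : Relation.ReflTransGen (AEdge S) p q) (h' : APath S b q r) : APath S b p r := by
  induction h using Relation.ReflTransGen.head_induction_on with
  | refl => exact h'
  | head he _ ih =>
    rcases he with he | he
    · exact (APath.cons false (by simpa using he) ih).weak (by simp)
    · exact (APath.cons true (by simpa using he) ih).weak (by simp)

theorem ASp.path {S : Set TGD} {p q : Pos} (h : ASp S p q) : APath S true p q := by
  obtain ⟨r, s, h1, h2, h3⟩ := h
  have h4 : APath S false q q := ⟨0, fun _ => q, fun _ => false, rfl, rfl, by simp, by simp⟩
  exact APath.rtg h1 ((APath.cons true (by simpa using h2) (APath.rtg h3 h4)).weak (by simp))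

def ASupp (D : Database) (S : Set TGD) (R : ℕ × ℕ) : Prop := ∃ a ∈ D, Reach S a.sig R

theorem aux_irrefl {D : Database} {S : Set TGD} (hwa : DWeaklyAcyclic D S) {p : Pos}
    (hs : ASupp D S p.1) : ¬ ASp S p p := by
  intro h
  obtain ⟨n, c, sp, h0, hn, he, hb⟩ := h.path
  obtain ⟨i, hi, hsp⟩ := hb rfl
  obtain ⟨m, rfl⟩ : ∃ m, n = m + 1 := ⟨n - 1, by omega⟩
  exact hwa ⟨m, c, sp, by rw [hn, h0], fun j hj => he j (by omega), ⟨i, by omega, hsp⟩,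
    ⟨0, by omega, by rw [h0]; exact hs⟩⟩

theorem AEdge.predEdge {S : Set TGD} {p q : Pos} (h : AEdge S p q) : predEdge S p.1 q.1 := by
  rcases h with ⟨σ, hσ, x, _, ⟨a, ha, hp⟩, ⟨b, hb, hq⟩⟩ | ⟨σ, hσ, x, _, ⟨a, ha, hp⟩, ⟨z, _, b, hb, hq⟩⟩
  · exact ⟨σ, hσ, ⟨a, ha, hp.1.symm⟩, ⟨b, hb, hq.1.symm⟩⟩
  · exact ⟨σ, hσ, ⟨a, ha, hp.1.symm⟩, ⟨b, hb, hq.1.symm⟩⟩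

/-- The set of positions of `S`. -/
def APosSet (S : Set TGD) : Set Pos := {p | p.1 ∈ sch S ∧ p.2 < p.1.2}

theorem aux_occ {T : Type} {x : T} {a : Atom T} {p : Pos} (h : occursAt x a p) : p.2 < p.1.2 := by
  obtain ⟨h1, h2⟩ := h
  rw [h1]
  exact (List.getElem?_eq_some_iff.1 h2).1

theorem AEdge.src {S : Set TGD} {p q : Pos} (h : AEdge S p q) : p ∈ APosSet S := by
  rcases h with ⟨σ, hσ, x, _, ⟨a, ha, hp⟩, _⟩ | ⟨σ, hσ, x, _, ⟨a, ha, hp⟩, _⟩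
  · exact ⟨⟨σ, hσ, a, by simp [TGD.atomsList, ha], hp.1.symm⟩, aux_occ hp⟩
  · exact ⟨⟨σ, hσ, a, by simp [TGD.atomsList, ha], hp.1.symm⟩, aux_occ hp⟩

theorem ASp.src {S : Set TGD} {p q : Pos} (h : ASp S p q) : p ∈ APosSet S := by
  obtain ⟨r, s, h1, h2, h3⟩ := h
  rcases Relation.ReflTransGen.cases_head h1 with rfl | ⟨c, hc, _⟩
  · exact AEdge.src (Or.inr h2)
  · exact hc.src

theorem ASp.tail {S : Set TGD} {p q r : Pos} (h : ASp S p q) (he : AEdge S q r) : ASp S p r := by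
  obtain ⟨u, v, h1, h2, h3⟩ := h
  exact ⟨u, v, h1, h2, h3.tail he⟩

def ARankSet (S : Set TGD) (p : Pos) : Set Pos := {q | ASp S q p}

noncomputable def ARank (S : Set TGD) (p : Pos) : ℕ := (ARankSet S p).ncard

theorem ARankSet_sub (S : Set TGD) (p : Pos) : ARankSet S p ⊆ APosSet S := fun _ h => ASp.src h

theorem ARank_mono {S : Set TGD} (hf : (APosSet S).Finite) {p q : Pos} (h : AEdge S p q) :
    ARank S p ≤ ARank S q :=
  Set.ncard_le_ncard (fun _ hr => ASp.tail hr h) (hf.subset (ARankSet_sub S q))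

theorem ARank_lt {D : Database} {S : Set TGD} (hwa : DWeaklyAcyclic D S)
    (hf : (APosSet S).Finite) {p q : Pos} (hs : ASupp D S p.1) (h : SpecialEdge S p q) :
    ARank S p + 1 ≤ ARank S q := by
  apply Set.ncard_lt_ncard _ (hf.subset (ARankSet_sub S q))
  refine ⟨fun _ hr => ASp.tail hr (Or.inr h), fun hsub => ?_⟩
  have : p ∈ ARankSet S q := ⟨p, q, .refl, h, .refl⟩
  exact aux_irrefl hwa hs (hsub this)

theorem ARank_bound {D : Database} {S : Set TGD} (hwa : DWeaklyAcyclic D S)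
    (hf : (APosSet S).Finite) {p : Pos} (hs : ASupp D S p.1) (hp : p ∈ APosSet S) :
    ARank S p + 1 ≤ (APosSet S).ncard := by
  apply Set.ncard_lt_ncard _ hf
  exact ⟨ARankSet_sub S p, fun hsub => aux_irrefl hwa hs (hsub hp)⟩

/-! schema finiteness and counting -/

theorem aux_sch_finite {S : Set TGD} (hfin : S.Finite) : (sch S).Finite := by
  have : sch S = ⋃ σ ∈ S, ((fun a : Atom ℕ => a.sig) '' {a | a ∈ σ.atomsList}) := by
    ext p; simp [sch]
  rw [this]
  exact hfin.biUnion fun σ _ => (List.finite_toSet _).image _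

theorem aux_arity_le {S : Set TGD} (hfin : S.Finite) {p : ℕ × ℕ} (hp : p ∈ sch S) :
    p.2 ≤ arity S :=
  le_csSup ((aux_sch_finite hfin).image _).bddAbove ⟨p, hp, rfl⟩

theorem aux_simple_sch {S : Set TGD} {R : ℕ × ℕ} (h : R ∈ sch (simpleTGDs S)) :
    ∃ a : Atom ℕ, a.sig ∈ sch S ∧ R = (simpleAtom a).sig := by
  obtain ⟨τ, ⟨σ, hσ, f, hf, rfl⟩, a, ha, rfl⟩ := h
  simp only [TGD.atomsList, TGD.simplify, List.mem_append, List.mem_singleton,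
    List.mem_map] at ha
  rcases ha with rfl | ⟨b, hb, rfl⟩
  · refine ⟨_, ⟨σ, hσ, σ.bodyAtom, ?_, ?_⟩, rfl⟩
    · simp [TGD.atomsList, TGD.bodyAtom]
    · simp [Atom.sig, Atom.map]
  · refine ⟨_, ⟨σ, hσ, b, ?_, ?_⟩, rfl⟩
    · simp [TGD.atomsList, hb]
    · simp [Atom.sig, Atom.map]

noncomputable def AEnc (A : ℕ) (x : (ℕ × ℕ) × (Fin A → Fin A) × Fin A) : Pos :=
  let l : List ℕ := (List.range x.1.2).map (fun k => if h : k < A then (x.2.1 ⟨k, h⟩ : ℕ) else 0)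
  ((Nat.pair x.1.1 (Encodable.encode l), (uniqueList l).length), x.2.2)

theorem aux_pos_sub {S : Set TGD} (hfin : S.Finite) :
    APosSet (simpleTGDs S) ⊆ (((aux_sch_finite hfin).toFinset ×ˢ
      (Finset.univ : Finset ((Fin (arity S) → Fin (arity S)) × Fin (arity S)))).image
        (AEnc (arity S)) : Finset Pos) := by
  rintro ⟨R, i⟩ ⟨h1, h2⟩
  obtain ⟨a, ha, rfl⟩ := aux_simple_sch h1
  have hlen : a.args.length ≤ arity S := aux_arity_le hfin ha
  have hu := aux_len_uniq a.args
  simp only [Atom.sig, simpleAtom] at h2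
  have hlt : ∀ k, (idTuple a.args).getD k 0 < arity S := by
    intro k
    by_cases hk : k < (idTuple a.args).length
    · have := aux_idTuple_lt a.args ((idTuple a.args)[k]) (List.getElem_mem hk)
      rw [List.getD_eq_getElem _ _ hk]; omega
    · rw [List.getD_eq_default _ _ (by omega)]; omega
  rw [Finset.mem_coe, Finset.mem_image]
  refine ⟨(a.sig, fun k => ⟨(idTuple a.args).getD k 0, hlt k⟩, ⟨i, by omega⟩), by simpa using ha, ?_⟩
  have hl : ((List.range a.args.length).map (fun k => if h : k < arity S then
      (idTuple a.args).getD k 0 else 0)) = idTuple a.args := by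
    apply List.ext_getElem
    · simp [aux_len_idTuple]
    · intro k hk1 hk2
      have : k < a.args.length := by simpa using hk1
      simp only [List.getElem_map, List.getElem_range]
      rw [dif_pos (by omega), List.getD_eq_getElem _ _ hk2]
  simp only [AEnc, Atom.sig, simpleAtom]
  rw [hl, aux_uniq_idTuple]

theorem aux_pos_finite {S : Set TGD} (hfin : S.Finite) : (APosSet (simpleTGDs S)).Finite :=
  (Finset.finite_toSet _).subset (aux_pos_sub hfin)

theorem aux_pos_card {S : Set TGD} (hfin : S.Finite) :
    (APosSet (simpleTGDs S)).ncard ≤ dL S := by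
  refine (Set.ncard_le_ncard (aux_pos_sub hfin) (Finset.finite_toSet _)).trans ?_
  rw [Set.ncard_coe_finset]
  refine Finset.card_image_le.trans ?_
  rw [Finset.card_product, dL, Set.ncard_eq_toFinset_card _ (aux_sch_finite hfin), pow_succ]
  simp

/-! variables -/

theorem aux_mem_foldr (l : List (Atom ℕ)) (x : ℕ) :
    x ∈ l.foldr (fun a s => atomVars a ∪ s) ∅ ↔ ∃ a ∈ l, x ∈ a.args := by
  induction l with
  | nil => simp
  | cons a l ih =>
    rw [List.foldr_cons, Finset.mem_union, ih]
    simp [atomVars]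

theorem aux_bodyVars (σ : TGD) (x : ℕ) : x ∈ σ.bodyVars ↔ ∃ a ∈ σ.body, x ∈ a.args :=
  aux_mem_foldr _ _

theorem aux_headVars (σ : TGD) (x : ℕ) : x ∈ σ.headVars ↔ ∃ a ∈ σ.head, x ∈ a.args :=
  aux_mem_foldr _ _

open Classical in
noncomputable def ASpec (xs : List ℕ) (h : ℕ → TermT) (v : ℕ) : ℕ :=
  if v ∈ xs then (xs.find? (fun w => decide (h w = h v))).getD v else v

theorem ASpec_off {xs : List ℕ} {h : ℕ → TermT} {v : ℕ} (hv : v ∉ xs) : ASpec xs h v = v := by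
  simp [ASpec, hv]

open Classical in
theorem ASpec_find {xs : List ℕ} {h : ℕ → TermT} {v : ℕ} (hv : v ∈ xs) :
    xs.find? (fun w => decide (h w = h v)) = some (ASpec xs h v) := by
  have : (xs.find? (fun w => decide (h w = h v))).isSome := by
    rw [List.find?_isSome]; exact ⟨v, hv, by simp⟩
  obtain ⟨w, hw⟩ := Option.isSome_iff_exists.1 this
  simp [ASpec, hv, hw]

theorem ASpec_mem {xs : List ℕ} {h : ℕ → TermT} {v : ℕ} (hv : v ∈ xs) : ASpec xs h v ∈ xs :=
  List.mem_of_find?_eq_some (ASpec_find hv)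

theorem ASpec_h {xs : List ℕ} {h : ℕ → TermT} {v : ℕ} (hv : v ∈ xs) :
    h (ASpec xs h v) = h v := by
  simpa using List.find?_some (ASpec_find (h := h) hv)

theorem ASpec_eq {xs : List ℕ} {h : ℕ → TermT} {v w : ℕ} (hv : v ∈ xs) (hw : w ∈ xs)
    (e : h v = h w) : ASpec xs h v = ASpec xs h w := by
  have h1 := ASpec_find (h := h) hv
  have h2 := ASpec_find (h := h) hw
  rw [e, h2] at h1
  exact (Option.some.inj h1).symm

theorem ASpec_spec (xs : List ℕ) (h : ℕ → TermT) : IsSpecialization xs (ASpec xs h) := by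
  classical
  refine ⟨fun v hv => ASpec_off hv, fun i => ?_⟩
  have hm : xs.get i ∈ xs := List.get_mem _ _
  have hf := ASpec_find (h := h) hm
  by_cases hex : ∃ w ∈ xs.take i, h w = h (xs.get i)
  · obtain ⟨w, hw, e⟩ := hex
    rw [List.mem_append]; left
    rw [← ASpec_eq (List.mem_of_mem_take hw) hm e]
    exact List.mem_map_of_mem hw
  · rw [List.mem_append]; right
    have hd : xs = xs.take i ++ xs.get i :: xs.drop (i + 1) := by simp
    have hn : (xs.take i).find? (fun w => decide (h w = h (xs.get i))) = none := by
      rw [List.find?_eq_none]; intro w hw e; exact hex ⟨w, hw, by simpa using e⟩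
    have : xs.find? (fun w => decide (h w = h (xs.get i))) = some (xs.get i) := by
      have h2 : (xs.take i ++ xs.get i :: xs.drop (i + 1)).find?
          (fun w => decide (h w = h (xs.get i))) = some (xs.get i) := by
        rw [List.find?_append, hn]; simp
      rwa [← hd] at h2
    rw [this] at hf
    rw [← Option.some.inj hf]; exact List.mem_singleton.2 rfl

/-! main invariant -/

theorem aux_depth_null (σ : TGD) (h : ℕ → TermT) (z : ℕ) :
    (TermT.null σ h z).depth = 1 + σ.frontier.sup (fun x => (h x).depth) := by
  rw [TermT.depth]

theorem aux_depth_restrict (σ : TGD) (h : ℕ → TermT) (z x : ℕ) (hx : x ∈ σ.frontier) :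
    (h x).depth < (TermT.null σ (σ.restrict h) z).depth := by
  rw [aux_depth_null]
  have := Finset.le_sup (f := fun x => (σ.restrict h x).depth) hx
  simp only [TGD.restrict, if_pos hx] at this
  simp only [TGD.restrict]
  omega

def AInv (D : Database) (S : Set TGD) (a : Atom TermT) : Prop :=
  ASupp (simpleDB D) (simpleTGDs S) (simpleAtom a).sig ∧
  ∀ (i : ℕ) (t : TermT), (simpleAtom a).args[i]? = some t →
    t.depth = 0 ∨ ((((simpleAtom a).sig, i) : Pos) ∈ APosSet (simpleTGDs S) ∧
      t.depth ≤ ARank (simpleTGDs S) ((simpleAtom a).sig, i) + 1)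

theorem aux_sig_map {T U : Type} (a : Atom T) (f : T → U) : (a.map f).sig = a.sig := by
  simp [Atom.sig, Atom.map]

theorem aux_map_map {T U V : Type} (a : Atom T) (f : T → U) (g : U → V) :
    (a.map f).map g = a.map (g ∘ f) := by
  simp [Atom.map]

theorem aux_map_congr {T U : Type} (a : Atom T) (f g : T → U) (h : ∀ x ∈ a.args, f x = g x) :
    a.map f = a.map g := by
  simp only [Atom.map]; rw [List.map_congr_left h]

theorem aux_inv {D : Database} {S : Set TGD} (hfin : S.Finite)
    (hlin : ∀ σ ∈ S, σ.Linear)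
    (hwa : DWeaklyAcyclic (simpleDB D) (simpleTGDs S)) {a : Atom TermT}
    (ha : InChase D S a) : AInv D S a := by
  classical
  induction ha with
  | @db a ha =>
    have hs : simpleAtom (a.map TermT.const) = (simpleAtom a).map TermT.const :=
      aux_simple_map a _ (fun x _ y _ e => by simpa using e)
    refine ⟨?_, ?_⟩
    · rw [hs, aux_sig_map]
      exact ⟨simpleAtom a, Finset.mem_image_of_mem _ ha, .refl⟩
    · intro i t ht
      left
      rw [hs] at ht
      have := List.mem_of_getElem? ht
      obtain ⟨c, _, rfl⟩ := List.mem_map.1 this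
      rw [TermT.depth]
  | @step σ hσ h hb a ha ih =>
    obtain ⟨b0, hb0⟩ := hlin σ hσ
    obtain ⟨b, hbh, rfl⟩ := ha
    have hba : σ.bodyAtom = b0 := by simp [TGD.bodyAtom, hb0]
    have hbv : ∀ x, x ∈ σ.bodyVars ↔ x ∈ b0.args := by
      intro x; rw [aux_bodyVars, hb0]; simp
    have hfrv : ∀ x, x ∈ σ.frontier → x ∈ b0.args := fun x hx =>
      (hbv x).1 (Finset.mem_inter.1 hx).1
    set f := ASpec b0.args h with hfdef
    set τ := σ.simplify f with hτdef
    have hτ : τ ∈ simpleTGDs S := ⟨σ, hσ, f, by rw [hba]; exact ASpec_spec _ _, rfl⟩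
    obtain ⟨hsupp, hpos⟩ := ih b0 (by simp [hb0])
    -- body
    have hbody : simpleAtom (b0.map h) = (simpleAtom (b0.map f)).map h := by
      rw [← aux_simple_map, aux_map_map]
      · rw [aux_map_congr b0 h (h ∘ f)]
        intro x hx; exact (ASpec_h hx).symm
      · intro x hx y hy e
        obtain ⟨x', hx', rfl⟩ := List.mem_map.1 hx
        obtain ⟨y', hy', rfl⟩ := List.mem_map.1 hy
        exact ASpec_eq hx' hy' ((ASpec_h hx').symm.trans (e.trans (ASpec_h hy')))
    -- head
    set g : ℕ → TermT := fun v => if v ∈ σ.bodyVars then h v else .null σ (σ.restrict h) v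
    have hcase : ∀ x ∈ b.args, (x ∈ σ.frontier ∧ f x ∈ σ.bodyVars) ∨
        (x ∉ σ.bodyVars ∧ f x = x ∧ x ∉ σ.frontier) := by
      intro x hx
      by_cases hxb : x ∈ σ.bodyVars
      · left
        exact ⟨Finset.mem_inter.2 ⟨hxb, (aux_headVars _ _).2 ⟨b, hbh, hx⟩⟩,
          (hbv _).2 (ASpec_mem ((hbv _).1 hxb))⟩
      · right
        exact ⟨hxb, ASpec_off (fun h => hxb ((hbv _).2 h)), fun h => hxb (Finset.mem_inter.1 h).1⟩
    have hgf : ∀ x ∈ σ.frontier, g (f x) = h x := by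
      intro x hx
      have : f x ∈ σ.bodyVars := (hbv _).2 (ASpec_mem (hfrv x hx))
      simp only [g, if_pos this]
      exact ASpec_h (hfrv x hx)
    have hgz : ∀ x, x ∉ σ.bodyVars → g x = .null σ (σ.restrict h) x := by
      intro x hx; simp only [g, if_neg hx]
    have hhead : simpleAtom (b.map (σ.mu h)) = (simpleAtom (b.map f)).map g := by
      rw [← aux_simple_map, aux_map_map]
      · rw [aux_map_congr b (σ.mu h) (g ∘ f)]
        intro x hx
        rcases hcase x hx with ⟨h1, h2⟩ | ⟨h1, h2, h3⟩
        · simp only [TGD.mu, if_pos h1, Function.comp, hgf x h1]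
        · simp only [TGD.mu, if_neg h3, Function.comp, h2, hgz x h1]
      · intro x hx y hy e
        obtain ⟨x', hx', rfl⟩ := List.mem_map.1 hx
        obtain ⟨y', hy', rfl⟩ := List.mem_map.1 hy
        rcases hcase x' hx' with ⟨h1, h2⟩ | ⟨h1, h2, h3⟩ <;>
        rcases hcase y' hy' with ⟨k1, k2⟩ | ⟨k1, k2, k3⟩
        · rw [hgf _ h1, hgf _ k1] at e
          exact ASpec_eq (hfrv _ h1) (hfrv _ k1) e
        · rw [hgf _ h1, k2, hgz _ k1] at e
          have := aux_depth_restrict σ h y' x' h1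
          rw [e] at this; omega
        · rw [hgf _ k1, h2, hgz _ h1] at e
          have := aux_depth_restrict σ h x' y' k1
          rw [← e] at this; omega
        · rw [h2, k2, hgz _ h1, hgz _ k1] at e
          rw [h2, k2]
          simpa using e
    have hτb : simpleAtom (b0.map f) ∈ τ.body := by simp [τ, TGD.simplify, hba]
    have hτh : simpleAtom (b.map f) ∈ τ.head := List.mem_map.2 ⟨b, hbh, rfl⟩
    have hsig0 : (simpleAtom (b0.map h)).sig = (simpleAtom (b0.map f)).sig := by
      rw [hbody, aux_sig_map]
    have hsig : (simpleAtom (b.map (σ.mu h))).sig = (simpleAtom (b.map f)).sig := by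
      rw [hhead, aux_sig_map]
    have hτfr : ∀ x ∈ σ.frontier, f x ∈ τ.frontier := by
      intro x hx
      obtain ⟨b1, hb1, hx1⟩ := (aux_headVars _ _).1 (Finset.mem_inter.1 hx).2
      refine Finset.mem_inter.2 ⟨(aux_bodyVars _ _).2 ⟨_, hτb, ?_⟩,
        (aux_headVars _ _).2 ⟨simpleAtom (b1.map f), List.mem_map.2 ⟨b1, hb1, rfl⟩, ?_⟩⟩
      · exact (aux_mem_uniq _ _).2 (List.mem_map_of_mem (hfrv x hx))
      · exact (aux_mem_uniq _ _).2 (List.mem_map_of_mem hx1)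
    have hocc : ∀ x ∈ σ.frontier, ∃ j : ℕ,
        occursAt (f x) (simpleAtom (b0.map f)) ((simpleAtom (b0.map h)).sig, j) ∧
        (simpleAtom (b0.map h)).args[j]? = some (h x) := by
      intro x hx
      have hm : f x ∈ (simpleAtom (b0.map f)).args :=
        (aux_mem_uniq _ _).2 (List.mem_map_of_mem (hfrv x hx))
      obtain ⟨j, hj⟩ := List.mem_iff_getElem?.1 hm
      refine ⟨j, ⟨hsig0, hj⟩, ?_⟩
      rw [hbody]
      change ((simpleAtom (b0.map f)).args.map h)[j]? = _
      rw [List.getElem?_map, hj, Option.map_some]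
      rw [show h (f x) = h x from ASpec_h (hfrv x hx)]
    refine ⟨?_, ?_⟩
    · obtain ⟨d, hd, hr⟩ := hsupp
      exact ⟨d, hd, hr.tail ⟨τ, hτ, ⟨_, hτb, hsig0.symm⟩, ⟨_, hτh, hsig.symm⟩⟩⟩
    · intro i t ht
      rw [hhead] at ht
      simp only [Atom.map, List.getElem?_map, Option.map_eq_some_iff] at ht
      obtain ⟨v, hv, rfl⟩ := ht
      have hv' : occursAt v (simpleAtom (b.map f)) ((simpleAtom (b.map (σ.mu h))).sig, i) :=
        ⟨hsig, hv⟩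
      have hmem : (((simpleAtom (b.map (σ.mu h))).sig, i) : Pos) ∈ APosSet (simpleTGDs S) :=
        ⟨⟨τ, hτ, _, List.mem_append_right _ hτh, hsig.symm⟩, aux_occ hv'⟩
      have hvm : v ∈ (b.map f).args := (aux_mem_uniq _ _).1 (List.mem_of_getElem? hv)
      obtain ⟨x, hx, rfl⟩ := List.mem_map.1 hvm
      rcases hcase x hx with ⟨h1, h2⟩ | ⟨h1, h2, h3⟩
      · rw [hgf x h1]
        obtain ⟨j, hj, hj'⟩ := hocc x h1
        rcases hpos j _ hj' with h0 | ⟨_, hd⟩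
        · exact Or.inl h0
        · right
          refine ⟨hmem, hd.trans (Nat.add_le_add_right (ARank_mono (aux_pos_finite hfin) ?_) 1)⟩
          exact Or.inl ⟨τ, hτ, f x, hτfr x h1, ⟨_, hτb, hj⟩, ⟨_, hτh, hv'⟩⟩
      · right
        refine ⟨hmem, ?_⟩
        rw [h2, hgz x h1, aux_depth_null, add_comm]
        refine Nat.add_le_add_right (Finset.sup_le ?_) 1
        intro y hy
        simp only [TGD.restrict, if_pos hy]
        obtain ⟨j, hj, hj'⟩ := hocc y hy
        rcases hpos j _ hj' with h0 | ⟨_, hd⟩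
        · omega
        · refine hd.trans (ARank_lt hwa (aux_pos_finite hfin) hsupp ?_)
          refine ⟨τ, hτ, f y, hτfr y hy, ⟨_, hτb, hj⟩, ⟨f x, ?_, _, hτh, hv'⟩⟩
          refine Finset.mem_sdiff.2 ⟨(aux_headVars _ _).2 ⟨_, hτh, List.mem_of_getElem? hv⟩, ?_⟩
          intro hcon
          obtain ⟨c, hc, hc'⟩ := (aux_bodyVars _ _).1 hcon
          simp only [τ, TGD.simplify, hba, List.mem_singleton] at hc
          subst hc
          obtain ⟨w, hw, e⟩ := List.mem_map.1 ((aux_mem_uniq _ _).1 hc')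
          apply h1
          rw [← h2, ← e]
          exact (hbv _).2 (ASpec_mem hw)

theorem aux_depth_bound {D : Database} {S : Set TGD} (hfin : S.Finite)
    (hlin : ∀ σ ∈ S, σ.Linear)
    (hwa : DWeaklyAcyclic (simpleDB D) (simpleTGDs S)) {t : TermT}
    (ht : t ∈ adom (chase D S)) : t.depth ≤ dL S := by
  obtain ⟨a, ha, hta⟩ := ht
  obtain ⟨hs, h⟩ := aux_inv hfin hlin hwa ha
  obtain ⟨i, hi⟩ := List.mem_iff_getElem?.1
    (show t ∈ (simpleAtom a).args from (aux_mem_uniq _ _).2 hta)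
  rcases h i t hi with h0 | ⟨hp, hd⟩
  · omega
  · exact hd.trans ((ARank_bound hwa (aux_pos_finite hfin) hs hp).trans (aux_pos_card hfin))

/-! finiteness -/

inductive AGood (D : Database) (S : Set TGD) : TermT → Prop
  | const (c : ℕ) (a : Atom ℕ) (ha : a ∈ D) (hc : c ∈ a.args) : AGood D S (.const c)
  | null (σ : TGD) (hσ : σ ∈ S) (h : ℕ → TermT) (z : ℕ) (hz : z ∈ σ.headVars)
      (hfr : ∀ x ∈ σ.frontier, AGood D S (h x))
      (hoff : ∀ x, x ∉ σ.frontier → h x = .const 0) : AGood D S (.null σ h z)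

theorem aux_good {D : Database} {S : Set TGD} {a : Atom TermT} (ha : InChase D S a) :
    (∀ t ∈ a.args, AGood D S t) ∧ a.sig ∈ ((fun b : Atom ℕ => b.sig) '' (D : Set (Atom ℕ))) ∪ sch S := by
  induction ha with
  | @db a ha =>
    refine ⟨?_, Or.inl ⟨a, ha, (aux_sig_map _ _).symm⟩⟩
    intro t ht
    obtain ⟨c, hc, rfl⟩ := List.mem_map.1 ht
    exact .const c a ha hc
  | @step σ hσ h hb a ha ih =>
    obtain ⟨b, hbh, rfl⟩ := ha
    refine ⟨?_, Or.inr ⟨σ, hσ, b, List.mem_append_right _ hbh, (aux_sig_map _ _).symm⟩⟩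
    have hfr : ∀ x ∈ σ.frontier, AGood D S (h x) := by
      intro x hx
      obtain ⟨c, hc, hxc⟩ := (aux_bodyVars _ _).1 (Finset.mem_inter.1 hx).1
      exact (ih c hc).1 _ (List.mem_map_of_mem hxc)
    intro t ht
    obtain ⟨x, hx, rfl⟩ := List.mem_map.1 ht
    by_cases hxf : x ∈ σ.frontier
    · simp only [TGD.mu, if_pos hxf]; exact hfr x hxf
    · simp only [TGD.mu, if_neg hxf]
      refine .null σ hσ _ x ((aux_headVars _ _).2 ⟨b, hbh, hx⟩) ?_ ?_
      · intro y hy; simp only [TGD.restrict, if_pos hy]; exact hfr y hy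
      · intro y hy; simp only [TGD.restrict, if_neg hy]

open Classical in
theorem aux_good_finite (D : Database) {S : Set TGD} (hfin : S.Finite) (k : ℕ) :
    {t | AGood D S t ∧ t.depth ≤ k}.Finite := by
  have hconst : (⋃ a ∈ (D : Set (Atom ℕ)), TermT.const '' {c | c ∈ a.args}).Finite :=
    D.finite_toSet.biUnion fun a _ => (List.finite_toSet _).image _
  induction k with
  | zero =>
    refine hconst.subset ?_
    rintro t ⟨ht, hd⟩
    cases ht with
    | const c a ha hc => exact Set.mem_biUnion ha ⟨c, hc, rfl⟩
    | null σ hσ h z hz hfr hoff => rw [aux_depth_null] at hd; omega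
  | succ k ih =>
    have hnull : (⋃ σ ∈ S, ⋃ z ∈ (σ.headVars : Set ℕ),
        (fun g : {x // x ∈ σ.frontier} → TermT =>
          TermT.null σ (fun x => if hx : x ∈ σ.frontier then g ⟨x, hx⟩ else .const 0) z) ''
          {g | ∀ x, g x ∈ {t | AGood D S t ∧ t.depth ≤ k}}).Finite :=
      hfin.biUnion fun σ _ => (Finset.finite_toSet _).biUnion fun z _ =>
        (Set.Finite.pi' fun _ => ih).image _
    refine (hconst.union hnull).subset ?_
    rintro t ⟨ht, hd⟩
    cases ht with
    | const c a ha hc => exact Or.inl (Set.mem_biUnion ha ⟨c, hc, rfl⟩)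
    | null σ hσ h z hz hfr hoff =>
      right
      refine Set.mem_biUnion hσ (Set.mem_biUnion (show z ∈ (σ.headVars : Set ℕ) from hz) ?_)
      refine ⟨fun x => h x, ?_, ?_⟩
      · intro x
        refine ⟨hfr x x.2, ?_⟩
        rw [aux_depth_null] at hd
        have := Finset.le_sup (f := fun x => (h x).depth) x.2
        change (h x).depth ≤ k
        omega
      · simp only
        congr 1
        funext x
        by_cases hx : x ∈ σ.frontier
        · simp [hx]
        · simp [hx, hoff x hx]

theorem aux_lists_finite {α : Type} {T : Set α} (hT : T.Finite) (n : ℕ) :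
    {l : List α | l.length = n ∧ ∀ t ∈ l, t ∈ T}.Finite := by
  have : Finite T := hT
  refine ((List.finite_length_eq T n).image (List.map Subtype.val)).subset ?_
  rintro l ⟨hl, ht⟩
  refine ⟨l.attach.map (fun t => ⟨t.1, ht t.1 t.2⟩), by simpa using hl, ?_⟩
  simp

theorem aux_chase_finite {D : Database} {S : Set TGD} (hfin : S.Finite)
    (hlin : ∀ σ ∈ S, σ.Linear)
    (hwa : DWeaklyAcyclic (simpleDB D) (simpleTGDs S)) : (chase D S).Finite := by
  have hT := aux_good_finite D hfin (dL S)
  have hP : (((fun b : Atom ℕ => b.sig) '' (D : Set (Atom ℕ))) ∪ sch S).Finite :=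
    (D.finite_toSet.image _).union (aux_sch_finite hfin)
  refine (hP.biUnion fun p _ => (aux_lists_finite hT p.2).image (fun l => Atom.mk p.1 l)).subset ?_
  intro a ha
  obtain ⟨h1, h2⟩ := aux_good ha
  refine Set.mem_biUnion h2 ⟨a.args, ⟨rfl, fun t ht => ⟨h1 t ht, ?_⟩⟩, rfl⟩
  exact aux_depth_bound hfin hlin hwa ⟨a, ha, ht⟩

end Helpers

/-- For `Σ ∈ L` with `simple(Σ)` being `simple(D)`-weakly-acyclic,
`maxdepth(D,Σ) ≤ d_L(Σ) = |sch(Σ)|·ar(Σ)^(ar(Σ)+1)`. -/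
theorem maxdepth_bound_linear (D : Database) (S : Set TGD) (hfin : S.Finite)
    (hlin : ∀ σ ∈ S, σ.Linear)
    (hwa : DWeaklyAcyclic (simpleDB D) (simpleTGDs S)) :
    maxdepth D S ≤ ((dL S : ℕ) : ℕ∞) := by
  rw [maxdepth, if_pos (aux_chase_finite hfin hlin hwa)]
  refine iSup₂_le fun t ht => ?_
  exact_mod_cast aux_depth_bound hfin hlin hwa ht
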